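/- Fix i with 1 ≤ i ≤ k and a column index m with 1 ≤ m ≤ n, and for 1 ≤ j ≤ r_i let b_{j,m} denote the m-th column of B_{i,j}. If b_{j,m} = 0 for some j, then b_{j',m} = 0 for all j' with j ≤ j' ≤ r_i. -/

import Mathlib

open Matrix Polynomial

/-- Uniqueness of the coefficients of a partial fraction expansion. -/
lemma pf_unique {k : ℕ} (lam : Fin k → ℂ) (hlam : Function.Injective lam) (r : Fin k → ℕ)
    (c : Fin k → ℕ → ℂ) (d : ℂ)
    (h : ∀ s : ℂ, (∀ i, s ≠ lam i) →
      ∑ i, ∑ j ∈ Finset.Icc 1 (r i), ((s - lam i) ^ j)⁻¹ * c i j = d)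
    (i : Fin k) (J : ℕ) (hJ : 1 ≤ J) (hJr : J ≤ r i) : c i J = 0 := by
  obtain ⟨t, ht⟩ : ∃ t, t = r i - J := ⟨_, rfl⟩
  induction t using Nat.strong_induction_on generalizing J with
  | _ t ih =>
  have hbig : ∀ j', J < j' → j' ≤ r i → c i j' = 0 := fun j' h1 h2 =>
    ih (r i - j') (by omega) j' (by omega) h2 rfl
  have hx0 : Filter.Tendsto (fun s : ℂ => s - lam i) (nhdsWithin (lam i) {lam i}ᶜ) (nhds 0) := by
    have : ContinuousAt (fun s : ℂ => s - lam i) (lam i) := by fun_prop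
    have h2 := this.tendsto
    simp only [sub_self] at h2
    exact h2.mono_left nhdsWithin_le_nhds
  have hpow : ∀ m : ℕ, 1 ≤ m → ∀ a : ℂ, Filter.Tendsto (fun s : ℂ => (s - lam i) ^ m * a)
      (nhdsWithin (lam i) {lam i}ᶜ) (nhds 0) := by
    intro m hm a
    have := (hx0.pow m).mul_const a
    rwa [zero_pow (by omega), zero_mul] at this
  have hne : ∀ᶠ s in nhdsWithin (lam i) {lam i}ᶜ, ∀ i', s ≠ lam i' := by
    rw [Filter.eventually_all]
    intro i'
    by_cases hi : i' = i
    · subst hi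
      exact self_mem_nhdsWithin
    · exact (eventually_ne_nhds (fun e => hi (hlam e).symm)).filter_mono nhdsWithin_le_nhds
  have hterm : ∀ i' : Fin k, ∀ j' ∈ Finset.Icc 1 (r i'),
      Filter.Tendsto (fun s : ℂ => (s - lam i) ^ J * (((s - lam i') ^ j')⁻¹ * c i' j'))
        (nhdsWithin (lam i) {lam i}ᶜ)
        (nhds (if i' = i then (if j' = J then c i J else 0) else 0)) := by
    intro i' j' hj'
    rw [Finset.mem_Icc] at hj'
    by_cases hi : i' = i
    · subst hi
      rcases lt_trichotomy j' J with hlt | heq | hgt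
      · rw [if_pos rfl, if_neg (by omega)]
        refine (hpow (J - j') (by omega) (c i' j')).congr' ?_
        filter_upwards [hne] with s hs
        have h0 : s - lam i' ≠ 0 := sub_ne_zero.2 (hs i')
        rw [← mul_assoc, pow_sub₀ _ h0 hlt.le]
      · subst heq
        rw [if_pos rfl, if_pos rfl]
        refine tendsto_const_nhds.congr' ?_
        filter_upwards [hne] with s hs
        have h0 : s - lam i' ≠ 0 := sub_ne_zero.2 (hs i')
        rw [← mul_assoc, mul_inv_cancel₀ (pow_ne_zero _ h0), one_mul]
      · rw [if_pos rfl, if_neg (by omega), hbig j' hgt hj'.2]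
        simp
    · rw [if_neg hi]
      have h0 : lam i - lam i' ≠ 0 := sub_ne_zero.2 (fun e => hi (hlam e).symm)
      have hc : ContinuousAt
          (fun s : ℂ => (s - lam i) ^ J * (((s - lam i') ^ j')⁻¹ * c i' j')) (lam i) := by
        refine ContinuousAt.mul (by fun_prop) (ContinuousAt.mul ?_ continuousAt_const)
        exact ContinuousAt.inv₀ (by fun_prop) (pow_ne_zero _ h0)
      have h2 := hc.tendsto
      simp only [sub_self, zero_pow (show J ≠ 0 by omega), zero_mul] at h2
      exact h2.mono_left nhdsWithin_le_nhds
  have hlim := tendsto_finsetSum Finset.univ (fun i' _ =>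
    tendsto_finsetSum (Finset.Icc 1 (r i')) (hterm i'))
  have hval : (∑ i' : Fin k, ∑ j' ∈ Finset.Icc 1 (r i'),
      (if i' = i then (if j' = J then c i J else 0) else 0)) = c i J := by
    rw [Finset.sum_eq_single i]
    · simp [hJ, hJr]
    · intro b _ hb
      simp [hb]
    · simp
  rw [hval] at hlim
  refine tendsto_nhds_unique hlim ((hpow J hJ d).congr' ?_)
  filter_upwards [hne] with s hs
  rw [← h s hs, Finset.mul_sum]
  simp_rw [Finset.mul_sum]

lemma shift_sum {M : Type*} [AddCommGroup M] [Module ℂ M] (x : ℂ) (hx : x ≠ 0) (f : ℕ → M)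
    (r : ℕ) :
    ∑ j ∈ Finset.Icc 1 r, (x ^ j)⁻¹ • x • f j + (x ^ r)⁻¹ • f (r + 1)
      = f 1 + ∑ j ∈ Finset.Icc 1 r, (x ^ j)⁻¹ • f (j + 1) := by
  induction r with
  | zero => simp
  | succ r ih =>
    rw [Finset.sum_Icc_succ_top (by omega), Finset.sum_Icc_succ_top (by omega), ← add_assoc, ← ih]
    have : (x ^ (r + 1))⁻¹ • x • f (r + 1) = (x ^ r)⁻¹ • f (r + 1) := by
      rw [smul_smul]
      congr 1
      field_simp
      ring
    rw [this]

/-- If the `m`-th column of `B i j` vanishes then so does the `m`-th column of `B i j'` for all `j ≤ j' ≤ r i`. -/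
theorem column_vanishing_propagates
    (n k : ℕ) (hn : 1 ≤ n)
    (A : Matrix (Fin n) (Fin n) ℂ)
    (lam : Fin k → ℂ) (hlam : Function.Injective lam)
    (r : Fin k → ℕ) (hr : ∀ i, 1 ≤ r i)
    (hsum : ∑ i, r i = n)
    (hchar : A.charpoly = ∏ i, (X - C (lam i)) ^ r i)
    (B : Fin k → ℕ → Matrix (Fin n) (Fin n) ℂ)
    (hB : ∀ s : ℂ, (∀ i, s ≠ lam i) →
      (s • (1 : Matrix (Fin n) (Fin n) ℂ) - A)⁻¹
        = ∑ i, ∑ j ∈ Finset.Icc 1 (r i), ((s - lam i) ^ j)⁻¹ • B i j)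
    :
    ∀ i : Fin k, ∀ m : Fin n, ∀ j : ℕ, 1 ≤ j → j ≤ r i →
      (fun p => B i j p m) = 0 →
        ∀ j' : ℕ, j ≤ j' → j' ≤ r i → (fun p => B i j' p m) = 0 := by
  have key : ∀ i j, 1 ≤ j → j + 1 ≤ r i →
      B i (j + 1) = (A - lam i • (1 : Matrix (Fin n) (Fin n) ℂ)) * B i j := by
    intro i j hj hjr
    let F : Fin k → ℕ → Matrix (Fin n) (Fin n) ℂ := fun i j => if j ≤ r i then B i j else 0
    let D : Fin k → ℕ → Matrix (Fin n) (Fin n) ℂ := fun i j =>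
      F i (j + 1) - (A - lam i • (1 : Matrix (Fin n) (Fin n) ℂ)) * F i j
    have hmain : ∀ s : ℂ, (∀ i, s ≠ lam i) →
        ∑ i, ∑ j ∈ Finset.Icc 1 (r i), ((s - lam i) ^ j)⁻¹ • D i j = 1 - ∑ i, F i 1 := by
      intro s hs
      have hdet : IsUnit (s • (1 : Matrix (Fin n) (Fin n) ℂ) - A).det := by
        have h1 : A.charpoly.eval s = (s • (1 : Matrix (Fin n) (Fin n) ℂ) - A).det := by
          rw [Matrix.eval_charpoly, Matrix.smul_one_eq_diagonal]
          rfl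
        rw [← h1, hchar, Polynomial.eval_prod, isUnit_iff_ne_zero, Finset.prod_ne_zero_iff]
        intro i _
        simp only [eval_pow, eval_sub, eval_X, eval_C]
        exact pow_ne_zero _ (sub_ne_zero.2 (hs i))
      have h1 := Matrix.mul_nonsing_inv _ hdet
      rw [hB s hs, Finset.mul_sum] at h1
      rw [eq_sub_iff_add_eq, ← h1, ← Finset.sum_add_distrib]
      refine Finset.sum_congr rfl fun i _ => ?_
      have hsh := shift_sum (s - lam i) (sub_ne_zero.2 (hs i)) (F i) (r i)
      have hF : F i (r i + 1) = 0 := if_neg (by omega)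
      rw [hF, smul_zero, add_zero] at hsh
      simp only [D, smul_sub, Finset.sum_sub_distrib]
      rw [sub_add_eq_add_sub, add_comm, ← hsh, ← Finset.sum_sub_distrib, Finset.mul_sum]
      refine Finset.sum_congr rfl fun j hj => ?_
      have hFj : F i j = B i j := if_pos (Finset.mem_Icc.1 hj).2
      rw [hFj, ← smul_sub, Matrix.mul_smul]
      congr 1
      simp only [sub_mul, smul_mul_assoc, one_mul, sub_smul]
      abel
    have hD : D i j = 0 := by
      ext p q
      refine pf_unique lam hlam r (fun i j => D i j p q) ((1 - ∑ i, F i 1) p q) ?_ i j hj (by omega)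
      intro s hs
      rw [← hmain s hs]
      simp [Matrix.sum_apply]
    have e1 : F i (j + 1) = B i (j + 1) := if_pos hjr
    have e2 : F i j = B i j := if_pos (by omega)
    simp only [D] at hD
    rw [e1, e2] at hD
    exact sub_eq_zero.1 hD
  intro i m j hj _ h0 j' hjj'
  induction j', hjj' using Nat.le_induction with
  | base => exact fun _ => h0
  | succ t ht ih =>
    intro htr
    have h1 := ih (by omega)
    funext p
    rw [key i t (by omega) htr, Matrix.mul_apply]
    refine Finset.sum_eq_zero fun q _ => ?_
    have := congrFun h1 q
    simp only [Pi.zero_apply] at this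
    rw [this, mul_zero]
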